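/- arXiv:1202.2451 — 2 statements merged into one kernel-verified Lean document; each statement's English description precedes it below -/
import Mathlib

section
/- Let K be a field and A a subring of K. The ultrafilter topology on Zar(K|A) coincides with the constructible (patch) topology associated with the Zariski topology on Zar(K|A), i.e., with the topology whose open sets are generated by the Boolean algebra of subsets of Zar(K|A) generated by the quasi-compact Zariski-open sets. -/
open TopologicalSpace

variable {K : Type*} [Field K]

/-- `Zar A` is the Zariski–Riemann space `Zar(K|A)`: the valuation subrings of `K` containing `A`. -/
abbrev Zar (A : Subring K) : Type _ := {V : ValuationSubring K // A ≤ V.toSubring}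

/-- `bo A S` is the set `B_S = {V ∈ Zar(K|A) : S ⊆ V}`. -/
def bo (A : Subring K) (S : Set K) : Set (Zar A) := {V | S ⊆ (V.1 : Set K)}

/-- For an ultrafilter `U` on a subset `Y` of `Zar(K|A)`, the set
`A_U = {x ∈ K : B_x ∩ Y ∈ U}`. -/
def ultraSet (A : Subring K) {Y : Set (Zar A)} (U : Ultrafilter Y) : Set K :=
  {x | {V : Y | x ∈ V.1.1} ∈ U}

/-- A subset `Y` of `Zar(K|A)` is stable for ultrafilters if `A_U ∈ Y` for every
ultrafilter `U` on `Y`. -/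
def UltraStable (A : Subring K) (Y : Set (Zar A)) : Prop :=
  ∀ (U : Ultrafilter Y) (W : Zar A), (W.1 : Set K) = ultraSet A U → W ∈ Y

/-- The Zariski topology on `Zar(K|A)`, with the sets `B_F` (`F ⊆ K` finite) as a basis. -/
def zarTop (A : Subring K) : TopologicalSpace (Zar A) :=
  generateFrom {S | ∃ F : Finset K, S = bo A ↑F}

/-- The `#`-topology on `Zar(K|A)`: the coarsest topology in which every `B_F`
(`F ⊆ K` finite) is both open and closed. -/
def sharpTop (A : Subring K) : TopologicalSpace (Zar A) :=
  generateFrom ({S | ∃ F : Finset K, S = bo A ↑F} ∪ {S | ∃ F : Finset K, S = (bo A ↑F)ᶜ})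

/-- The Boolean algebra of sets generated by a family `G` of subsets of `X`. -/
inductive BoolGen {X : Type*} (G : Set (Set X)) : Set X → Prop
  | base (s : Set X) (hs : s ∈ G) : BoolGen G s
  | compl (s : Set X) (hs : BoolGen G s) : BoolGen G sᶜ
  | union (s t : Set X) (hs : BoolGen G s) (ht : BoolGen G t) : BoolGen G (s ∪ t)
  | inter (s t : Set X) (hs : BoolGen G s) (ht : BoolGen G t) : BoolGen G (s ∩ t)

/-- The constructible topology associated with a topology `t` on `X`: the topology having as a
basis of open sets the Boolean algebra generated by the quasi-compact open subsets of `(X, t)`. -/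
def consTop {X : Type*} (t : TopologicalSpace X) : TopologicalSpace X :=
  generateFrom {s | BoolGen {U : Set X | t.IsOpen U ∧ @IsCompact X t U} s}

/-- The center map `γ : Zar(K|A) → Spec(A)` sending `V` to `M_V ∩ A`. -/
noncomputable def centerMap (A : Subring K) (V : Zar A) : PrimeSpectrum ↥A :=
  ⟨(IsLocalRing.maximalIdeal ↥V.1).comap (Subring.inclusion V.2), inferInstance⟩

/-- `x` belongs to the maximal ideal `M_V` of the valuation subring `V`. -/
def inMax (V : ValuationSubring K) (x : K) : Prop :=
  ∃ h : x ∈ V, (⟨x, h⟩ : ↥V) ∈ IsLocalRing.maximalIdeal ↥V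

/-- The constructible (patch) topology on `Spec R`: the coarsest topology in which every basic
open set `D_a = {P : a ∉ P}` is both open and closed. -/
def patchTop (R : Type*) [CommRing R] : TopologicalSpace (PrimeSpectrum R) :=
  generateFrom ({S | ∃ a : R, S = {P : PrimeSpectrum R | a ∉ P.asIdeal}} ∪
    {S | ∃ a : R, S = {P : PrimeSpectrum R | a ∉ P.asIdeal}ᶜ})

/-- The ultrafilter limit point set `P_U = {a ∈ R : V(a) ∩ C ∈ U}`. -/
def specLimitSet {R : Type*} [CommRing R] {C : Set (PrimeSpectrum R)} (U : Ultrafilter C) :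
    Set R :=
  {a | {P : C | a ∈ P.1.asIdeal} ∈ U}

/-- A subset `C ⊆ Spec R` is ultrafilter closed if it contains all of its ultrafilter limit
points. -/
def SpecStable {R : Type*} [CommRing R] (C : Set (PrimeSpectrum R)) : Prop :=
  ∀ (U : Ultrafilter C) (P : PrimeSpectrum R), (P.asIdeal : Set R) = specLimitSet U → P ∈ C

/-- `W` is the limit of the ultrafilter `U` on `Zar(K|A)`: it consists of those `x` such that
`B_x` belongs to `U`. -/
def IsUltraLimit (A : Subring K) (U : Ultrafilter (Zar A)) (W : Zar A) : Prop :=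
  ∀ x : K, x ∈ W.1 ↔ {V : Zar A | x ∈ V.1} ∈ U

theorem exists_isUltraLimit (A : Subring K) (U : Ultrafilter (Zar A)) :
    ∃ W : Zar A, IsUltraLimit A U W := by
  let R : ValuationSubring K :=
    { carrier := {x | {V : Zar A | x ∈ V.1} ∈ U}
      mul_mem' := fun {x y} hx hy => by
        filter_upwards [hx, hy] with V h₁ h₂ using mul_mem h₁ h₂
      one_mem' := Filter.Eventually.of_forall fun V => one_mem V.1
      add_mem' := fun {x y} hx hy => by
        filter_upwards [hx, hy] with V h₁ h₂ using add_mem h₁ h₂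
      zero_mem' := Filter.Eventually.of_forall fun V => zero_mem V.1
      neg_mem' := fun {x} hx => by
        filter_upwards [hx] with V h using neg_mem h
      mem_or_inv_mem' := fun x => Ultrafilter.eventually_or.1
        (Filter.Eventually.of_forall fun V : Zar A => V.1.mem_or_inv_mem x) }
  exact ⟨⟨R, fun x hx => Filter.Eventually.of_forall fun V : Zar A => V.2 hx⟩, fun x => Iff.rfl⟩

theorem IsUltraLimit.mem_bo_iff {A : Subring K} {U : Ultrafilter (Zar A)} {W : Zar A}
    (h : IsUltraLimit A U W) (F : Finset K) : W ∈ bo A ↑F ↔ bo A ↑F ∈ U := by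
  have hF : bo A (F : Set K) = ⋂ x ∈ F, {V : Zar A | x ∈ V.1} := by
    ext V
    simp [bo, Set.subset_def]
  have key : bo A (F : Set K) ∈ U ↔ ∀ x ∈ F, {V : Zar A | x ∈ V.1} ∈ U := by
    rw [hF]
    exact Filter.biInter_finset_mem F
  rw [key]
  exact forall₂_congr fun x _ => h x

theorem IsUltraLimit.le_nhds_zarTop {A : Subring K} {U : Ultrafilter (Zar A)} {W : Zar A}
    (h : IsUltraLimit A U W) : (U : Filter (Zar A)) ≤ @nhds _ (zarTop A) W := by
  rw [zarTop, nhds_generateFrom]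
  refine le_iInf₂ fun s hs => Filter.le_principal_iff.2 ?_
  obtain ⟨hW, F, rfl⟩ := hs
  exact (h.mem_bo_iff F).1 hW

theorem isOpen_bo (A : Subring K) (F : Finset K) : (zarTop A).IsOpen (bo A ↑F) :=
  GenerateOpen.basic _ ⟨F, rfl⟩

theorem isCompact_bo (A : Subring K) (F : Finset K) : @IsCompact _ (zarTop A) (bo A ↑F) := by
  let _ := zarTop A
  rw [isCompact_iff_ultrafilter_le_nhds]
  intro U hU
  obtain ⟨W, hW⟩ := exists_isUltraLimit A U
  exact ⟨W, (hW.mem_bo_iff F).2 (Filter.le_principal_iff.1 hU), hW.le_nhds_zarTop⟩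

theorem IsUltraLimit.mem_iff_of_isOpen_of_isCompact {A : Subring K} {U : Ultrafilter (Zar A)}
    {W : Zar A} (h : IsUltraLimit A U W) {s : Set (Zar A)} (hs : (zarTop A).IsOpen s)
    (hc : @IsCompact _ (zarTop A) s) : W ∈ s ↔ s ∈ U := by
  let _ := zarTop A
  refine ⟨fun hW => h.le_nhds_zarTop (IsOpen.mem_nhds hs hW), fun hU => ?_⟩
  obtain ⟨V, hV, hUV⟩ := isCompact_iff_ultrafilter_le_nhds.1 hc U (Filter.le_principal_iff.2 hU)
  have hsp : nhds W ≤ nhds V := by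
    conv_rhs => rw [show nhds V = _ from nhds_generateFrom]
    refine le_iInf₂ fun s hs => Filter.le_principal_iff.2 ?_
    obtain ⟨hVs, F, rfl⟩ := hs
    have hFU : bo A ↑F ∈ U := hUV (IsOpen.mem_nhds (isOpen_bo A F) hVs)
    exact IsOpen.mem_nhds (isOpen_bo A F) ((h.mem_bo_iff F).2 hFU)
  exact mem_of_mem_nhds (hsp (IsOpen.mem_nhds hs hV))

theorem IsUltraLimit.mem_iff_of_boolGen {A : Subring K} {U : Ultrafilter (Zar A)}
    {W : Zar A} (h : IsUltraLimit A U W) {s : Set (Zar A)}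
    (hs : BoolGen {U | (zarTop A).IsOpen U ∧ @IsCompact _ (zarTop A) U} s) :
    W ∈ s ↔ s ∈ U := by
  induction hs with
  | base s hs => exact h.mem_iff_of_isOpen_of_isCompact hs.1 hs.2
  | compl s _ ih => rw [Set.mem_compl_iff, ih, Ultrafilter.compl_mem_iff_notMem]
  | union s t _ _ ihs iht => rw [Set.mem_union, ihs, iht, Ultrafilter.union_mem_iff]
  | inter s t _ _ ihs iht => rw [Set.mem_inter_iff, ihs, iht]; exact Filter.inter_mem_iff.symm

theorem isUltraLimit_of_le_nhds_consTop {A : Subring K} {U : Ultrafilter (Zar A)} {W : Zar A}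
    (h : (U : Filter (Zar A)) ≤ @nhds _ (consTop (zarTop A)) W) : IsUltraLimit A U W := by
  let _ := consTop (zarTop A)
  intro x
  have hx : {V : Zar A | x ∈ V.1} = bo A ↑({x} : Finset K) := by
    ext V
    simp [bo]
  have hb : BoolGen {U | (zarTop A).IsOpen U ∧ @IsCompact _ (zarTop A) U}
      {V : Zar A | x ∈ V.1} := by
    rw [hx]
    exact .base _ ⟨isOpen_bo A _, isCompact_bo A _⟩
  refine ⟨fun hW => h (IsOpen.mem_nhds (GenerateOpen.basic _ hb) hW), fun hU => ?_⟩
  by_contra hW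
  exact Ultrafilter.compl_mem_iff_notMem.1
    (h (IsOpen.mem_nhds (GenerateOpen.basic _ (hb.compl _)) hW)) hU

theorem ultraStable_iff {A : Subring K} {Y : Set (Zar A)} :
    UltraStable A Y ↔ ∀ (U : Ultrafilter (Zar A)) (W : Zar A), Y ∈ U → IsUltraLimit A U W →
      W ∈ Y := by
  constructor
  · intro hY U W hU hW
    have hr : Set.range ((↑) : Y → Zar A) ∈ U := by rwa [Subtype.range_coe]
    refine hY (U.comap Subtype.val_injective hr) W (Set.ext fun x => (hW x).trans ?_)
    refine Iff.trans ?_ (Ultrafilter.mem_comap U Subtype.val_injective hr).symm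
    rw [show {V : Y | x ∈ V.1.1} = (↑) ⁻¹' {V : Zar A | x ∈ V.1} from rfl,
      Subtype.image_preimage_coe]
    exact ⟨fun h => Filter.inter_mem hU h, fun h => Filter.mem_of_superset h Set.inter_subset_right⟩
  · intro hY U W hW
    refine hY (U.map ((↑) : Y → Zar A)) W ?_ fun x => Set.ext_iff.1 hW x
    exact Ultrafilter.mem_map.2 (Filter.univ_mem' fun V : Y => V.2)

/-- The ultrafilter topology on `Zar(K|A)` coincides with the constructible
(patch) topology associated with the Zariski topology on `Zar(K|A)`. -/
theorem statement9 {K : Type*} [Field K] (A : Subring K)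
    (t : TopologicalSpace (Zar A)) (ht : ∀ C : Set (Zar A), @IsClosed _ t C ↔ UltraStable A C) :
    t = consTop (zarTop A) := by
  refine TopologicalSpace.ext_iff_isClosed.2 fun C => (ht C).trans ?_
  rw [ultraStable_iff]
  constructor
  · intro hC
    let _ := consTop (zarTop A)
    exact isClosed_iff_ultrafilter.2 fun W U hU hCU =>
      hC U W hCU (isUltraLimit_of_le_nhds_consTop hU)
  · intro hC U W hCU hW
    have ho : GenerateOpen _ Cᶜ := hC.isOpen_compl
    have key : ∀ s : Set (Zar A), (consTop (zarTop A)).IsOpen s → W ∈ s → s ∈ U := by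
      intro s hs hWs
      induction hs with
      | basic s hs => exact (hW.mem_iff_of_boolGen hs).1 hWs
      | univ => exact Filter.univ_mem
      | inter s t _ _ ihs iht => exact Filter.inter_mem (ihs hWs.1) (iht hWs.2)
      | sUnion S _ ih =>
        obtain ⟨s, hsS, hWs⟩ := hWs
        exact Filter.mem_of_superset (ih s hsS hWs) (Set.subset_sUnion_of_mem hsS)
    by_contra hWC
    exact Ultrafilter.compl_mem_iff_notMem.1 (key _ ho hWC) hCU
end

section
/- Let A be a Prüfer domain with quotient field K. Then the center map γ : Zar(K|A) → Spec(A), sending a valuation subring V with maximal ideal M_V to M_V ∩ A, is a homeomorphism when Zar(K|A) carries the ultrafilter topology and Spec(A) carries the constructible (patch) topology. -/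
open TopologicalSpace

variable {K : Type*} [Field K]

/-- The limit `A_U` of an ultrafilter `U` on a set of valuation subrings containing `A`, as a
point of `Zar(K|A)`. -/
def ultraLimit (A : Subring K) {Y : Set (Zar A)} (U : Ultrafilter Y) : Zar A :=
  ⟨{ carrier := ultraSet A U
     mul_mem' := fun {_ _} hx hy => Filter.mem_of_superset (Filter.inter_mem hx hy)
       fun V hV => V.1.1.mul_mem _ _ hV.1 hV.2
     one_mem' := Filter.univ_mem' fun V => V.1.1.one_mem
     add_mem' := fun {_ _} hx hy => Filter.mem_of_superset (Filter.inter_mem hx hy)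
       fun V hV => V.1.1.add_mem _ _ hV.1 hV.2
     zero_mem' := Filter.univ_mem' fun V => V.1.1.zero_mem
     neg_mem' := fun {_} hx => Filter.mem_of_superset hx fun V hV => V.1.1.neg_mem _ hV
     mem_or_inv_mem' := fun x => Ultrafilter.union_mem_iff.1 <|
       Filter.univ_mem' fun V => V.1.1.mem_or_inv_mem x },
    fun _ ha => Filter.univ_mem' fun V => V.1.2 ha⟩

theorem mem_ultraLimit {A : Subring K} {Y : Set (Zar A)} {U : Ultrafilter Y} {x : K} :
    x ∈ (ultraLimit A U).1 ↔ {V : Y | x ∈ V.1.1} ∈ U :=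
  Iff.rfl

theorem UltraStable.ultraLimit_mem {A : Subring K} {Y : Set (Zar A)} (hY : UltraStable A Y)
    (U : Ultrafilter Y) : ultraLimit A U ∈ Y :=
  hY U _ rfl

theorem ultraStable_setOf_mem (A : Subring K) (x : K) :
    UltraStable A {V : Zar A | x ∈ V.1} := by
  intro U W hW
  change x ∈ (W.1 : Set K)
  rw [hW]
  exact Filter.univ_mem' fun V => V.2

theorem ultraStable_setOf_notMem (A : Subring K) (x : K) :
    UltraStable A {V : Zar A | x ∉ V.1} := by
  intro U W hW hx
  change x ∈ (W.1 : Set K) at hx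
  rw [hW] at hx
  obtain ⟨V, hV⟩ := U.nonempty_of_mem hx
  exact V.2 hV

theorem mem_centerMap_iff {A : Subring K} {V : Zar A} {a : A} :
    a ∈ (centerMap A V).asIdeal ↔ (a : K) = 0 ∨ (a : K)⁻¹ ∉ V.1 := by
  change Subring.inclusion V.2 a ∈ IsLocalRing.maximalIdeal V.1 ↔ _
  rw [ValuationSubring.valuation_lt_one_iff, ← not_iff_not, not_or, not_not, not_lt,
    ← ValuationSubring.valuation_le_one_iff, map_inv₀]
  change _ ≤ V.1.valuation (a : K) ↔ _
  by_cases h : (a : K) = 0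
  · simp [h]
  · have hv : V.1.valuation (a : K) ≠ 0 := (Valuation.ne_zero_iff _).2 h
    simp [h, inv_le_one₀ (zero_lt_iff.2 hv)]

theorem notMem_centerMap_iff {A : Subring K} {V : Zar A} {a : A} :
    a ∉ (centerMap A V).asIdeal ↔ (a : K) ≠ 0 ∧ (a : K)⁻¹ ∈ V.1 := by
  rw [mem_centerMap_iff, not_or, not_not]

/-- If the localization of `A` at `P` is a valuation ring, then every element of the fraction
field of `A`, or its inverse, is a fraction with denominator outside `P`. -/
theorem exists_mul_eq_or_mul_eq_of_valuationRing (A : Subring K) [IsFractionRing A K]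
    (P : Ideal A) [P.IsPrime] [ValuationRing (Localization.AtPrime P)] (x : K) :
    ∃ a s : A, s ∉ P ∧ (x * s = a ∨ x * a = s) := by
  obtain ⟨b, d, hd, rfl⟩ := IsFractionRing.div_surjective (A := A) x
  have hd0 : (d : K) ≠ 0 := by
    simpa using nonZeroDivisors.ne_zero hd
  have hinj := IsLocalization.injective (Localization.AtPrime P)
    P.primeCompl_le_nonZeroDivisors
  have key : ∀ (b d : A) (c : Localization.AtPrime P),
      algebraMap A (Localization.AtPrime P) b * c = algebraMap A _ d →
      ∃ e s : A, s ∉ P ∧ b * e = d * s := by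
    intro b d c hc
    obtain ⟨e, s, rfl⟩ := IsLocalization.exists_mk'_eq P.primeCompl c
    refine ⟨e, s, s.2, hinj ?_⟩
    rw [map_mul, map_mul, ← hc, mul_assoc, IsLocalization.mk'_spec]
  change ∃ a s : A, s ∉ P ∧ ((b : K) / d * s = a ∨ (b : K) / d * a = s)
  obtain ⟨c, hc | hc⟩ := ValuationRing.cond (algebraMap A (Localization.AtPrime P) b)
    (algebraMap A (Localization.AtPrime P) d)
  · obtain ⟨e, s, hs, h⟩ := key _ _ _ hc
    have h' : (b : K) * e = d * s := congrArg Subtype.val h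
    refine ⟨e, s, hs, Or.inr ?_⟩
    field_simp
    exact h'
  · obtain ⟨e, s, hs, h⟩ := key _ _ _ hc
    have h' : (d : K) * e = b * s := congrArg Subtype.val h
    refine ⟨e, s, hs, Or.inl ?_⟩
    field_simp
    exact h'.symm

theorem centerMap_injective (A : Subring K) [IsFractionRing A K]
    (hA : ∀ (P : Ideal A) [P.IsPrime], ValuationRing (Localization.AtPrime P)) :
    Function.Injective (centerMap A) := by
  have key : ∀ V W : Zar A, centerMap A V = centerMap A W → V.1 ≤ W.1 := by
    intro V W h x hx
    have := hA (centerMap A V).asIdeal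
    obtain ⟨a, s, hs, e | e⟩ :=
      exists_mul_eq_or_mul_eq_of_valuationRing A (centerMap A V).asIdeal x
    · rw [h, notMem_centerMap_iff] at hs
      rw [(eq_mul_inv_iff_mul_eq₀ hs.1).2 e]
      exact W.1.mul_mem _ _ (W.2 a.2) hs.2
    · have hs' := notMem_centerMap_iff.1 hs
      have ha0 : (a : K) ≠ 0 := by
        intro h0
        exact hs'.1 (by rw [← e, h0, mul_zero])
      have ha : a ∉ (centerMap A V).asIdeal := by
        refine notMem_centerMap_iff.2 ⟨ha0, ?_⟩
        have : (a : K)⁻¹ = x * (s : K)⁻¹ := by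
          rw [← e] at hs' ⊢
          have := left_ne_zero_of_mul hs'.1
          field_simp
        rw [this]
        exact V.1.mul_mem _ _ hx hs'.2
      rw [h, notMem_centerMap_iff] at ha
      rw [(eq_mul_inv_iff_mul_eq₀ ha0).2 e]
      exact W.1.mul_mem _ _ (W.2 s.2) ha.2
  exact fun V W h => Subtype.ext (le_antisymm (key V W h) (key W V h.symm))

theorem centerMap_surjective (A : Subring K) : Function.Surjective (centerMap A) := by
  intro P
  have hP : ∀ s : P.asIdeal.primeCompl, IsUnit (A.subtype s) := fun s =>
    isUnit_iff_ne_zero.2 fun h => s.2 <| by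
      rw [show (s : A) = 0 from Subtype.ext h]
      exact zero_mem _
  let f : Localization.AtPrime P.asIdeal →+* K := IsLocalization.lift hP
  have hf : ∀ a : A, f (algebraMap A _ a) = a := IsLocalization.lift_eq hP
  obtain ⟨V, h, hloc⟩ := IsLocalRing.exists_factor_valuationRing f
  have hAV : A ≤ V.toSubring := fun a ha => by
    have := h (algebraMap A _ ⟨a, ha⟩)
    rwa [hf] at this
  refine ⟨⟨V, hAV⟩, PrimeSpectrum.ext (Ideal.ext fun a => ?_)⟩
  have hu : f.codRestrict V.toSubring h (algebraMap A _ a) = Subring.inclusion hAV a :=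
    Subtype.ext (hf a)
  change ¬ IsUnit (Subring.inclusion hAV a) ↔ _
  rw [← hu, isUnit_map_iff (f.codRestrict V.toSubring h),
    IsLocalization.AtPrime.isUnit_to_map_iff _ P.asIdeal]
  exact not_not

theorem continuous_centerMap (A : Subring K) (t : TopologicalSpace (Zar A))
    (ht : ∀ C : Set (Zar A), UltraStable A C → @IsClosed _ t C) :
    @Continuous _ _ t (patchTop A) (centerMap A) := by
  have key : ∀ a : A, IsClopen (centerMap A ⁻¹' {P | a ∉ P.asIdeal}) := by
    intro a
    by_cases h : (a : K) = 0
    · convert isClopen_empty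
      ext V
      simpa using mem_centerMap_iff.2 (Or.inl h)
    · have : centerMap A ⁻¹' {P | a ∉ P.asIdeal} = {V : Zar A | (a : K)⁻¹ ∈ V.1} := by
        ext V
        exact notMem_centerMap_iff.trans (and_iff_right h)
      rw [this]
      refine ⟨ht _ (ultraStable_setOf_mem A _), isClosed_compl_iff.1 ?_⟩
      exact ht _ (ultraStable_setOf_notMem A _)
  refine continuous_generateFrom_iff.2 ?_
  rintro _ (⟨a, rfl⟩ | ⟨a, rfl⟩)
  · exact (key a).isOpen
  · exact (key a).compl.isOpen

theorem isClosed_image_centerMap {A : Subring K} {C : Set (Zar A)} (hC : UltraStable A C) :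
    @IsClosed _ (patchTop A) (centerMap A '' C) := by
  let := patchTop A
  refine isClosed_of_closure_subset fun P hP => ?_
  let g : C → PrimeSpectrum A := fun V => centerMap A V
  have : (Filter.comap g (nhds P)).NeBot := by
    refine Filter.comap_neBot fun s hs => ?_
    obtain ⟨_, hx, V, hV, rfl⟩ := mem_closure_iff_nhds.1 hP s hs
    exact ⟨⟨V, hV⟩, hx⟩
  let U := Ultrafilter.of (Filter.comap g (nhds P))
  have hU : Filter.Tendsto g U (nhds P) := Filter.tendsto_iff_comap.2 (Ultrafilter.of_le _)
  have hD : ∀ a : A, a ∉ P.asIdeal → ∀ᶠ V in U, a ∉ (g V).asIdeal := fun a ha =>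
    hU ((isOpen_generateFrom_of_mem (Or.inl ⟨a, rfl⟩)).mem_nhds ha)
  have hV : ∀ a : A, a ∈ P.asIdeal → ∀ᶠ V in U, ¬ a ∉ (g V).asIdeal := fun a ha =>
    hU ((isOpen_generateFrom_of_mem (Or.inr ⟨a, rfl⟩)).mem_nhds (not_not.2 ha))
  refine ⟨ultraLimit A U, hC.ultraLimit_mem U, PrimeSpectrum.ext (Ideal.ext fun a => ?_)⟩
  rw [← not_iff_not, notMem_centerMap_iff, mem_ultraLimit]
  constructor
  · rintro ⟨h0, h⟩ ha
    obtain ⟨V, hV₁, hV₂⟩ := U.nonempty_of_mem (Filter.inter_mem h (hV a ha))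
    exact hV₂ (notMem_centerMap_iff.2 ⟨h0, hV₁⟩)
  · refine fun ha => ⟨fun h0 => ha ?_, ?_⟩
    · rw [show a = 0 from Subtype.ext h0]
      exact zero_mem _
    · exact Filter.mem_of_superset (hD a ha) fun V hV => (notMem_centerMap_iff.1 hV).2

/-- If `A` is a Prüfer domain (every localization of `A` at a prime is a
valuation domain) with quotient field `K`, then the center map `γ : Zar(K|A) → Spec(A)` is a
homeomorphism for the ultrafilter topology on `Zar(K|A)` and the constructible (patch) topology
on `Spec(A)`. -/
theorem statement17 {K : Type*} [Field K] (A : Subring K) [IsFractionRing ↥A K]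
    (hPrufer : ∀ (P : Ideal ↥A) [P.IsPrime], ValuationRing (Localization.AtPrime P))
    (t : TopologicalSpace (Zar A)) (ht : ∀ C : Set (Zar A), @IsClosed _ t C ↔ UltraStable A C) :
    @IsHomeomorph _ _ t (patchTop ↥A) (centerMap A) := by
  let := t
  let := patchTop A
  exact isHomeomorph_iff_continuous_isClosedMap_bijective.2
    ⟨continuous_centerMap A t fun C => (ht C).2,
      fun C hC => isClosed_image_centerMap ((ht C).1 hC),
      centerMap_injective A hPrufer, centerMap_surjective A⟩
end
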